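/- Suppose γ_n ≤ γ < 1 for all n ≥ 0, and let {(x_n, y_n)}_{n=0}^∞ be a solution of the system with positive initial conditions. If there exists a constant C > 0 such that x_n < C for all n ≥ 0, then limsup_{n→∞} y_n ≤ C/(1 − γ); in particular {y_n} is bounded from above. -/

import Mathlib

open Filter Topology

/-- The coefficient sequence extended to `ℤ` by the convention `γ₋₁ := γ₀`. -/
noncomputable def gext (γ : ℕ → ℝ) : ℤ → ℝ := fun j => if j < 0 then γ 0 else γ j.toNat

/-- `μ(i,1) = 1` and `μ(i,k) = ∏_{j=i-1}^{i+k-3} γ_j` for `k ≥ 2`. -/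
noncomputable def mu (γ : ℕ → ℝ) (i k : ℕ) : ℝ :=
  ∏ t ∈ Finset.range (k - 1), gext γ ((i : ℤ) - 1 + (t : ℤ))

/-- `φ(i,n) = ∑_{k=1}^n μ(i,k) x_{i+k}`. -/
noncomputable def phi (γ x : ℕ → ℝ) (i n : ℕ) : ℝ :=
  ∑ k ∈ Finset.Icc 1 n, mu γ i k * x (i + k)

/-- `w_n = (γ_{n-1} + x_n)/y_n`, where `γ₋₁ := γ₀` (Nat subtraction). -/
noncomputable def wseq (γ x y : ℕ → ℝ) (n : ℕ) : ℝ := (γ (n - 1) + x n) / y n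

/-- A solution with positive initial conditions stays positive. -/
theorem solution_pos {γ x y : ℕ → ℝ} (hγpos : ∀ n, 0 < γ n) (hx0 : 0 < x 0) (hy0 : 0 < y 0)
    (hx : ∀ n, x (n + 1) = x n / y n) (hy : ∀ n, y (n + 1) = x n + γ n * y n) (n : ℕ) :
    0 < x n ∧ 0 < y n := by
  induction n with
  | zero => exact ⟨hx0, hy0⟩
  | succ n ih =>
    obtain ⟨hxn, hyn⟩ := ih
    have hγn := hγpos n
    rw [hx, hy]
    constructor <;> positivity

/-- Discrete Grönwall bound for a linear recursive inequality with contraction factor `g < 1`. -/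
theorem le_geometric_of_le_add_mul {y : ℕ → ℝ} {g C : ℝ} (hg0 : 0 ≤ g) (hg : g < 1) (hC : 0 ≤ C)
    (h : ∀ n, y (n + 1) ≤ C + g * y n) (n : ℕ) :
    y n ≤ g ^ n * y 0 + C / (1 - g) := by
  have hg' : 0 < 1 - g := sub_pos.mpr hg
  induction n with
  | zero =>
    have : 0 ≤ C / (1 - g) := by positivity
    simpa using this
  | succ n ih =>
    calc y (n + 1) ≤ C + g * y n := h n
      _ ≤ C + g * (g ^ n * y 0 + C / (1 - g)) := by gcongr
      _ = g ^ (n + 1) * y 0 + C / (1 - g) := by field_simp; ring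

/-- If `γₙ ≤ g < 1` for all `n` and `xₙ < C` for all `n`, then
`limsup yₙ ≤ C/(1−g)`; in particular `{yₙ}` is bounded above. -/
theorem stmt16 (γ x y : ℕ → ℝ) (g C : ℝ)
    (hγhi : ∀ n, γ n ≤ g) (hg : g < 1)
    (hγpos : ∀ n, 0 < γ n)
    (hx0 : 0 < x 0) (hy0 : 0 < y 0)
    (hx : ∀ n, x (n + 1) = x n / y n)
    (hy : ∀ n, y (n + 1) = x n + γ n * y n)
    (hC : 0 < C) (hxC : ∀ n, x n < C) :
    Filter.limsup y Filter.atTop ≤ C / (1 - g) ∧ ∃ B : ℝ, ∀ n, y n ≤ B := by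
  have hpos := solution_pos hγpos hx0 hy0 hx hy
  have hg0 : 0 ≤ g := (hγpos 0).le.trans (hγhi 0)
  have hbound := le_geometric_of_le_add_mul (y := y) hg0 hg hC.le fun n => by
    rw [hy]
    exact add_le_add (hxC n).le (mul_le_mul_of_nonneg_right (hγhi n) (hpos n).2.le)
  have hlim : Tendsto (fun n => g ^ n * y 0 + C / (1 - g)) atTop (𝓝 (C / (1 - g))) := by
    simpa using ((tendsto_pow_atTop_nhds_zero_of_lt_one hg0 hg).mul_const (y 0)).add_const
      (C / (1 - g))
  refine ⟨?_, y 0 + C / (1 - g), fun n => (hbound n).trans ?_⟩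
  · rw [← hlim.limsup_eq]
    exact limsup_le_limsup (Eventually.of_forall hbound)
      (isCoboundedUnder_le_of_le atTop fun n => (hpos n).2.le) hlim.isBoundedUnder_le
  · have := mul_le_of_le_one_left hy0.le (pow_le_one₀ (n := n) hg0 hg.le)
    linarith
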